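/- Let d ≥ 1, δ' ∈ (0,2), T₁ > 0 and C_Z > 0. Let Ẑ : [0,T₁] → ℓ¹₁(ℤ^d) be continuous with sup_{τ∈[0,T₁]} ‖Ẑ(τ)‖_{ℓ¹₁} ≤ C_Z, and let B̂₀ ∈ ℓ¹_{3−δ'}(ℤ^d). Then there exists T₀ ∈ (0,T₁], depending only on d, δ', C_Z and ‖B̂₀‖_{ℓ¹_{3−δ'}}, and a unique continuous B̂ : [0,T₀] → ℓ¹_{3−δ'}(ℤ^d) satisfying for all K ∈ ℤ^d and T ∈ [0,T₀] the integral equation B̂(K,T) = e^{−(4|K|²+1)T} B̂₀(K) + ∫₀^T e^{−(4|K|²+1)(T−τ)} (2Ẑ(K,τ) − 3((B̂+Ẑ) * (B̂+Ẑ) * C(B̂+Ẑ))(K,τ)) dτ, where (C ĝ)(K) = \overline{ĝ(−K)}. -/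

import Mathlib

/-- The weight `(1 + |K|²)^{r/2}` on the lattice `ℤ^d`. -/
noncomputable def wt (d : ℕ) (r : ℝ) (K : Fin d → ℤ) : ℝ :=
  (1 + ∑ i, ((K i : ℝ)) ^ 2) ^ (r / 2)

/-- Discrete convolution on `ℤ^d`: `(û * v̂)(K) = Σ_L û(K−L) v̂(L)`. -/
noncomputable def dconv (d : ℕ) (u v : (Fin d → ℤ) → ℂ) (K : Fin d → ℤ) : ℂ :=
  ∑' L : Fin d → ℤ, u (K - L) * v L

/-- Fourier representation of complex conjugation: `(C ĝ)(K) = conj (ĝ(−K))`. -/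
noncomputable def cjop (d : ℕ) (g : (Fin d → ℤ) → ℂ) : (Fin d → ℤ) → ℂ :=
  fun K => (starRingEnd ℂ) (g (-K))

/-- Continuity of `T ↦ B(T)` on `[0,T₀]` with respect to the `ℓ¹_r` norm. -/
def NormContOn (d : ℕ) (r T₀ : ℝ) (B : ℝ → (Fin d → ℤ) → ℂ) : Prop :=
  ∀ T ∈ Set.Icc (0 : ℝ) T₀, ∀ η > 0, ∃ ν > 0, ∀ T' ∈ Set.Icc (0 : ℝ) T₀,
    |T' - T| < ν → ∑' K : Fin d → ℤ, ‖B T' K - B T K‖ * wt d r K < η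

/-- `B` is a mild (variation-of-constants) solution on `[0,T₀]`, with values in
`ℓ¹_r`, of `∂_T B = 4Δ_X B + B + 2Z − 3|B+Z|²(B+Z)` in Fourier space:
`B̂(K,T) = e^{−(4|K|²+1)T} B̂₀(K) + ∫₀^T e^{−(4|K|²+1)(T−τ)}
(2Ẑ(K,τ) − 3((B̂+Ẑ)*(B̂+Ẑ)*C(B̂+Ẑ))(K,τ)) dτ`. -/
def IsMildSol (d : ℕ) (T₀ r : ℝ) (Z : ℝ → (Fin d → ℤ) → ℂ)
    (B₀ : (Fin d → ℤ) → ℂ) (B : ℝ → (Fin d → ℤ) → ℂ) : Prop :=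
  (∀ T ∈ Set.Icc (0 : ℝ) T₀, Summable (fun K => ‖B T K‖ * wt d r K)) ∧
  NormContOn d r T₀ B ∧
  (∀ T ∈ Set.Icc (0 : ℝ) T₀, ∀ K : Fin d → ℤ,
    B T K = (Real.exp (-((4 * ∑ i, ((K i : ℝ)) ^ 2) + 1) * T)) • B₀ K
      + ∫ τ in (0 : ℝ)..T,
          (Real.exp (-((4 * ∑ i, ((K i : ℝ)) ^ 2) + 1) * (T - τ))) •
            (2 * Z τ K
              - 3 * dconv d
                  (dconv d (fun L => B τ L + Z τ L) (fun L => B τ L + Z τ L))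
                  (cjop d (fun L => B τ L + Z τ L)) K))

section AbstractMild

open Set Filter Topology MeasureTheory

theorem continuousOn_kernel {F : Type*} [TopologicalSpace F] {P : ℝ → F → F} {g : ℝ → F}
    (hP : ContinuousOn (Function.uncurry P) (Ioi 0 ×ˢ univ))
    (hg : Continuous g) (t : ℝ) : ContinuousOn (fun r => P r (g (t - r))) (Ioi 0) :=
  hP.comp (by fun_prop : ContinuousOn (fun r => (r, g (t - r))) (Ioi 0))
    fun _ hr => ⟨hr, mem_univ _⟩

theorem intervalIntegrable_singular_kernel {F : Type*} [NormedAddCommGroup F]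
    {P : ℝ → F → F} {θ : ℝ} {g : ℝ → F}
    (hP : ContinuousOn (Function.uncurry P) (Ioi 0 ×ˢ univ))
    (hP_le : ∀ r, 0 < r → ∀ x, ‖P r x‖ ≤ r ^ (-θ) * ‖x‖) (hθ : θ < 1) (hg : Continuous g)
    {t : ℝ} (ht : 0 ≤ t) :
    IntervalIntegrable (fun r => P r (g (t - r))) volume 0 t := by
  obtain ⟨G, hG⟩ := isCompact_Icc.exists_bound_of_continuousOn (s := Icc 0 t) hg.continuousOn
  have hint : IntervalIntegrable (fun r : ℝ => r ^ (-θ) * G) volume 0 t :=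
    (intervalIntegral.intervalIntegrable_rpow' (by linarith)).mul_const G
  refine hint.mono_fun' ?_ ?_
  · rw [uIoc_of_le ht]
    exact ((continuousOn_kernel hP hg t).mono Ioc_subset_Ioi_self).aestronglyMeasurable
      measurableSet_Ioc
  · rw [uIoc_of_le ht]
    filter_upwards [ae_restrict_mem measurableSet_Ioc] with r hr
    refine (hP_le r hr.1 _).trans ?_
    have := Real.rpow_nonneg hr.1.le (-θ)
    gcongr
    exact hG _ ⟨by linarith [hr.2], by linarith [hr.1]⟩

variable {E : Type*} [NormedAddCommGroup E] [NormedSpace ℝ E]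

theorem continuous_duhamel {S : ℝ → E → E} (hS : Continuous (Function.uncurry S))
    {g : ℝ → E} (hg : Continuous g) :
    Continuous fun t => ∫ τ in (0 : ℝ)..t, S (t - τ) (g τ) := by
  apply intervalIntegral.continuous_parametric_intervalIntegral_of_continuous (s := fun t => t) _
    continuous_id
  exact hS.comp (by fun_prop : Continuous fun p : ℝ × ℝ => (p.1 - p.2, g p.2))

/-- Local existence of mild solutions, by the contraction principle on a ball of continuous
paths; the propagator `S` is nonexpansive and the nonlinearity `N` is Lipschitz on the ball. -/
theorem exists_mild_solution [CompleteSpace E] {S N : ℝ → E → E}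
    (hS : Continuous (Function.uncurry S)) (hS_lip : ∀ t x y, ‖S t x - S t y‖ ≤ ‖x - y‖)
    (hS_zero : ∀ t, S t 0 = 0) (hN : Continuous (Function.uncurry N)) {R M L T : ℝ}
    (hM : ∀ t x, ‖x‖ ≤ R → ‖N t x‖ ≤ M)
    (hL : ∀ t x y, ‖x‖ ≤ R → ‖y‖ ≤ R → ‖N t x - N t y‖ ≤ L * ‖x - y‖)
    {x₀ : E} (hx₀ : ‖x₀‖ + T * M ≤ R) (hT : 0 ≤ T) (hM0 : 0 ≤ M) (hL0 : 0 ≤ L)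
    (hTL : T * L < 1) :
    ∃ u : ℝ → E, Continuous u ∧
      ∀ t ∈ Icc 0 T, u t = S t x₀ + ∫ τ in (0 : ℝ)..t, S (t - τ) (N τ (u τ)) := by
  have hS_norm : ∀ t x, ‖S t x‖ ≤ ‖x‖ := fun t x => by
    simpa [hS_zero] using hS_lip t x 0
  have hR : 0 ≤ R := le_trans (by positivity) hx₀
  let path : C(Icc 0 T, Metric.closedBall (0 : E) R) → ℝ → E := fun u t => (u (projIcc 0 T hT t)).1
  have path_cont : ∀ u, Continuous (path u) := fun u =>
    continuous_subtype_val.comp (u.continuous.comp continuous_projIcc)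
  have path_le : ∀ u t, ‖path u t‖ ≤ R := fun u t =>
    mem_closedBall_zero_iff.1 (u (projIcc 0 T hT t)).2
  let Φ : (ℝ → E) → ℝ → E := fun u t => S t x₀ + ∫ τ in (0 : ℝ)..t, S (t - τ) (N τ (u τ))
  have N_cont : ∀ u, Continuous u → Continuous fun τ => N τ (u τ) := fun u hu =>
    hN.comp (continuous_id.prodMk hu)
  have Φ_cont : ∀ u, Continuous u → Continuous (Φ u) := fun u hu =>
    (hS.comp (by fun_prop : Continuous fun t : ℝ => (t, x₀))).add
      (continuous_duhamel hS (N_cont u hu))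
  have integrand_cont : ∀ u (t : ℝ), Continuous u → Continuous fun τ => S (t - τ) (N τ (u τ)) :=
    fun u t hu => hS.comp ((continuous_const.sub continuous_id).prodMk (N_cont u hu))
  have Φ_mem : ∀ u, ∀ t ∈ Icc 0 T, Φ (path u) t ∈ Metric.closedBall (0 : E) R := by
    intro u t ht
    have h1 : ‖∫ τ in (0 : ℝ)..t, S (t - τ) (N τ (path u τ))‖ ≤ M * |t - 0| :=
      intervalIntegral.norm_integral_le_of_norm_le_const fun τ _ =>
        (hS_norm _ _).trans (hM _ _ (path_le u τ))
    rw [sub_zero, abs_of_nonneg ht.1] at h1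
    rw [mem_closedBall_zero_iff]
    calc ‖Φ (path u) t‖ ≤ ‖S t x₀‖ + M * t := (norm_add_le _ _).trans (by gcongr)
      _ ≤ ‖x₀‖ + M * T := by gcongr; exacts [hS_norm _ _, ht.2]
      _ ≤ R := by linarith
  let Ψ : C(Icc 0 T, Metric.closedBall (0 : E) R) → C(Icc 0 T, Metric.closedBall (0 : E) R) :=
    fun u => ⟨fun t => ⟨Φ (path u) t, Φ_mem u t t.2⟩,
      ((Φ_cont _ (path_cont u)).comp continuous_subtype_val).subtype_mk _⟩
  have hΨ : ContractingWith (T * L).toNNReal Ψ := by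
    refine ⟨by simpa using hTL, LipschitzWith.of_dist_le_mul fun u v => ?_⟩
    rw [Real.coe_toNNReal _ (by positivity), ContinuousMap.dist_le (by positivity)]
    intro t
    have hd : ∀ τ, ‖path u τ - path v τ‖ ≤ dist u v := fun τ => by
      rw [← dist_eq_norm]
      exact ContinuousMap.dist_apply_le_dist (f := u) (g := v) (projIcc 0 T hT τ)
    have h1 : ‖∫ τ in (0 : ℝ)..t, (S (t - τ) (N τ (path u τ)) - S (t - τ) (N τ (path v τ)))‖
        ≤ L * dist u v * |(t : ℝ) - 0| := by
      refine intervalIntegral.norm_integral_le_of_norm_le_const fun τ _ => ?_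
      calc _ ≤ ‖N τ (path u τ) - N τ (path v τ)‖ := hS_lip _ _ _
        _ ≤ L * ‖path u τ - path v τ‖ := hL _ _ _ (path_le _ _) (path_le _ _)
        _ ≤ _ := by gcongr; exact hd τ
    rw [intervalIntegral.integral_sub ((integrand_cont _ _ (path_cont u)).intervalIntegrable _ _)
      ((integrand_cont _ _ (path_cont v)).intervalIntegrable _ _), sub_zero,
      abs_of_nonneg t.2.1] at h1
    have h2 : dist (Ψ u t) (Ψ v t) = ‖(∫ τ in (0 : ℝ)..t, S (t - τ) (N τ (path u τ))) -
        ∫ τ in (0 : ℝ)..t, S (t - τ) (N τ (path v τ))‖ := by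
      rw [Subtype.dist_eq, dist_eq_norm]
      simp only [Ψ, Φ, ContinuousMap.coe_mk, add_sub_add_left_eq_sub]
    rw [h2]
    refine h1.trans ?_
    have := t.2.2
    calc L * dist u v * t ≤ L * dist u v * T := by gcongr
      _ = _ := by ring
  have : CompleteSpace (Metric.closedBall (0 : E) R) :=
    Metric.isClosed_closedBall.completeSpace_coe
  have : Nonempty C(Icc 0 T, Metric.closedBall (0 : E) R) :=
    ⟨ContinuousMap.const _ ⟨0, Metric.mem_closedBall_self hR⟩⟩
  have hfix := hΨ.fixedPoint_isFixedPt
  refine ⟨path (ContractingWith.fixedPoint Ψ hΨ), path_cont _, fun t ht => ?_⟩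
  have := congrArg (fun v => (v ⟨t, ht⟩ : E)) hfix
  simp only [path, projIcc_of_mem hT ht]
  exact this.symm

/-- Unconditional uniqueness of mild solutions, by Grönwall's inequality. -/
theorem mild_solution_unique {S N : ℝ → E → E}
    (hS : Continuous (Function.uncurry S)) (hS_lip : ∀ t x y, ‖S t x - S t y‖ ≤ ‖x - y‖)
    (hN : Continuous (Function.uncurry N)) {T : ℝ}
    (hL : ∀ R, ∃ L, 0 ≤ L ∧
      ∀ t x y, ‖x‖ ≤ R → ‖y‖ ≤ R → ‖N t x - N t y‖ ≤ L * ‖x - y‖)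
    {x₀ : E} {u v : ℝ → E} (hu : Continuous u) (hv : Continuous v)
    (hu_eq : ∀ t ∈ Icc 0 T, u t = S t x₀ + ∫ τ in (0 : ℝ)..t, S (t - τ) (N τ (u τ)))
    (hv_eq : ∀ t ∈ Icc 0 T, v t = S t x₀ + ∫ τ in (0 : ℝ)..t, S (t - τ) (N τ (v τ))) :
    ∀ t ∈ Icc 0 T, u t = v t := by
  obtain ⟨Ru, hRu⟩ := isCompact_Icc.exists_bound_of_continuousOn (s := Icc 0 T) hu.continuousOn
  obtain ⟨Rv, hRv⟩ := isCompact_Icc.exists_bound_of_continuousOn (s := Icc 0 T) hv.continuousOn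
  obtain ⟨L, hL0, hL⟩ := hL (max Ru Rv)
  have hc : Continuous fun t => ‖u t - v t‖ := (hu.sub hv).norm
  have integrand_cont : ∀ w (t : ℝ), Continuous w → Continuous fun τ => S (t - τ) (N τ (w τ)) :=
    fun w t hw => hS.comp
      ((continuous_const.sub continuous_id).prodMk (hN.comp (continuous_id.prodMk hw)))
  have key : ∀ t ∈ Icc 0 T, ‖u t - v t‖ ≤ L * ∫ τ in (0 : ℝ)..t, ‖u τ - v τ‖ := by
    intro t ht
    rw [hu_eq t ht, hv_eq t ht, add_sub_add_left_eq_sub,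
      ← intervalIntegral.integral_sub ((integrand_cont _ _ hu).intervalIntegrable _ _)
      ((integrand_cont _ _ hv).intervalIntegrable _ _), ← intervalIntegral.integral_const_mul]
    refine intervalIntegral.norm_integral_le_of_norm_le ht.1 (ae_of_all _ fun τ hτ => ?_)
      ((continuous_const.mul hc).intervalIntegrable _ _)
    have hτ' : τ ∈ Icc 0 T := ⟨hτ.1.le, hτ.2.trans ht.2⟩
    exact (hS_lip _ _ _).trans
      (hL _ _ _ ((hRu τ hτ').trans (le_max_left _ _)) ((hRv τ hτ').trans (le_max_right _ _)))
  have hzero : ∀ t ∈ Icc 0 T, ∫ τ in (0 : ℝ)..t, ‖u τ - v τ‖ = 0 := by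
    refine eq_zero_of_abs_deriv_le_mul_abs_self_of_eq_zero_right (K := L)
      (f' := fun t => ‖u t - v t‖)
      (continuous_iff_continuousAt.2 fun t =>
        (hc.integral_hasStrictDerivAt 0 t).hasDerivAt.continuousAt).continuousOn
      (fun t _ => (hc.integral_hasStrictDerivAt 0 t).hasDerivAt.hasDerivWithinAt)
      (by simp) fun t ht => ?_
    rw [norm_norm]
    refine (key t (Ico_subset_Icc_self ht)).trans ?_
    gcongr
    exact le_abs_self _
  intro t ht
  have := key t ht
  rw [hzero t ht, mul_zero] at this
  exact sub_eq_zero.1 (norm_le_zero_iff.1 this)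

section Singular

variable {P : ℝ → E → E} {θ : ℝ} {g : ℝ → E}

/-- A Duhamel integral whose kernel has an integrable singularity at the origin is continuous. -/
theorem continuousOn_singular_duhamel
    (hP : ContinuousOn (Function.uncurry P) (Ioi 0 ×ˢ univ))
    (hP_le : ∀ r, 0 < r → ∀ x, ‖P r x‖ ≤ r ^ (-θ) * ‖x‖) (hθ : θ < 1) (hg : Continuous g)
    (T : ℝ) :
    ContinuousOn (fun t => ∫ r in (0 : ℝ)..t, P r (g (t - r))) (Icc 0 T) := by
  obtain ⟨G, hG⟩ := isCompact_Icc.exists_bound_of_continuousOn (s := Icc 0 T) hg.continuousOn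
  have hcongr : ∀ t ∈ Icc 0 T, (∫ r in (0 : ℝ)..t, P r (g (t - r))) =
      ∫ r in (0 : ℝ)..T, indicator {r | r ≤ t} (fun r => P r (g (t - r))) r :=
    fun t ht => (intervalIntegral.integral_indicator ht).symm
  refine ContinuousOn.congr (fun t₀ ht₀ => ?_) hcongr
  have hT : 0 ≤ T := ht₀.1.trans ht₀.2
  refine intervalIntegral.continuousWithinAt_of_dominated_interval
    (bound := fun r => r ^ (-θ) * G) ?_ ?_
    ((intervalIntegral.intervalIntegrable_rpow' (by linarith)).mul_const G) ?_
  · refine Eventually.of_forall fun t => AEStronglyMeasurable.indicator ?_ measurableSet_Iic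
    rw [uIoc_of_le hT]
    exact ((continuousOn_kernel hP hg t).mono Ioc_subset_Ioi_self).aestronglyMeasurable
      measurableSet_Ioc
  · filter_upwards [self_mem_nhdsWithin] with t ht
    refine ae_of_all _ fun r hr => ?_
    rw [uIoc_of_le hT] at hr
    have := Real.rpow_nonneg hr.1.le (-θ)
    have hG0 : 0 ≤ G := (norm_nonneg _).trans (hG t ht)
    by_cases hrt : r ≤ t
    · rw [indicator_of_mem (by exact hrt)]
      refine (hP_le r hr.1 _).trans ?_
      gcongr
      exact hG _ ⟨by linarith, by linarith [hr.1, ht.2]⟩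
    · rw [indicator_of_notMem (by exact hrt), norm_zero]
      positivity
  · have hne : ∀ᵐ r : ℝ, r ≠ t₀ := by simp [ae_iff, measure_singleton]
    filter_upwards [hne] with r hr hr'
    rw [uIoc_of_le hT] at hr'
    apply ContinuousAt.continuousWithinAt
    rcases lt_or_gt_of_ne hr with h | h
    · have hev : (fun t => P r (g (t - r))) =ᶠ[𝓝 t₀]
          fun t => indicator {r | r ≤ t} (fun r => P r (g (t - r))) r := by
        filter_upwards [lt_mem_nhds h] with t ht
        rw [indicator_of_mem (by exact ht.le)]
      refine ContinuousAt.congr ?_ hev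
      have hcont : Continuous fun t => P r (g (t - r)) :=
        hP.comp_continuous (by fun_prop : Continuous fun t => (r, g (t - r)))
          fun _ => ⟨hr'.1, mem_univ _⟩
      exact hcont.continuousAt
    · have hev : (fun _ => (0 : E)) =ᶠ[𝓝 t₀]
          fun t => indicator {r | r ≤ t} (fun r => P r (g (t - r))) r := by
        filter_upwards [gt_mem_nhds h] with t ht
        rw [indicator_of_notMem (by simpa using ht)]
      exact continuousAt_const.congr hev

end Singular

end AbstractMild

section WeightedEllOne

open Filter Topology

variable {ι : Type*}

/-- The space `ℓ¹(ι)` of absolutely summable complex families. -/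
noncomputable abbrev EllOne (ι : Type*) : Type _ := ↥(lp (fun _ : ι => ℂ) 1)

theorem memℓp_one_iff {f : ι → ℂ} : Memℓp f 1 ↔ Summable fun K => ‖f K‖ := by
  simp [memℓp_gen_iff (p := 1) (by simp)]

theorem EllOne.summable_norm (f : EllOne ι) : Summable fun K => ‖f K‖ :=
  memℓp_one_iff.1 (lp.memℓp f)

theorem EllOne.norm_eq_tsum (f : EllOne ι) : ‖f‖ = ∑' K, ‖f K‖ := by
  simp [lp.norm_eq_tsum_rpow (p := 1) (by simp)]

/-- Multiplication of a family by a real weight, as an element of `ℓ¹`; it is `0` when the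
product is not absolutely summable. -/
noncomputable def wmul (c : ι → ℝ) (f : ι → ℂ) : EllOne ι :=
  open Classical in
  if h : Memℓp (fun K => (c K : ℂ) * f K) 1 then ⟨_, h⟩ else 0

theorem wmul_apply {c : ι → ℝ} {f : ι → ℂ} (h : Summable fun K => ‖f K‖ * c K)
    (hc : ∀ K, 0 ≤ c K) (K : ι) : wmul c f K = c K * f K := by
  have h' : Memℓp (fun K => (c K : ℂ) * f K) 1 := by
    rw [memℓp_one_iff]
    refine h.congr fun K => ?_
    rw [norm_mul, Complex.norm_of_nonneg (hc K), mul_comm]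
  rw [wmul, dif_pos h']

theorem summable_norm_mul_of_bound {c : ι → ℝ} {C : ℝ} (hc : ∀ K, 0 ≤ c K) (hC : ∀ K, c K ≤ C)
    (f : EllOne ι) : Summable fun K => ‖f K‖ * c K :=
  Summable.of_nonneg_of_le (fun K => mul_nonneg (norm_nonneg _) (hc K))
    (fun K => mul_le_mul_of_nonneg_left (hC K) (norm_nonneg _)) (f.summable_norm.mul_right C)

theorem norm_wmul_sub {c : ι → ℝ} {f g : ι → ℂ} (hf : Summable fun K => ‖f K‖ * c K)
    (hg : Summable fun K => ‖g K‖ * c K) (hc : ∀ K, 0 ≤ c K) :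
    ‖wmul c f - wmul c g‖ = ∑' K, ‖f K - g K‖ * c K := by
  rw [EllOne.norm_eq_tsum]
  refine tsum_congr fun K => ?_
  rw [lp.coeFn_sub, Pi.sub_apply, wmul_apply hf hc, wmul_apply hg hc, ← mul_sub, norm_mul,
    Complex.norm_of_nonneg (hc K), mul_comm]

theorem norm_wmul {c : ι → ℝ} {f : ι → ℂ} (hf : Summable fun K => ‖f K‖ * c K)
    (hc : ∀ K, 0 ≤ c K) : ‖wmul c f‖ = ∑' K, ‖f K‖ * c K := by
  rw [EllOne.norm_eq_tsum]
  refine tsum_congr fun K => ?_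
  rw [wmul_apply hf hc, norm_mul, Complex.norm_of_nonneg (hc K), mul_comm]

theorem norm_wmul_sub_le {c : ι → ℝ} {C : ℝ} (hc : ∀ K, 0 ≤ c K) (hC : ∀ K, c K ≤ C)
    (f g : EllOne ι) : ‖wmul c f - wmul c g‖ ≤ C * ‖f - g‖ := by
  have hf := summable_norm_mul_of_bound hc hC
  rw [norm_wmul_sub (hf f) (hf g) hc, EllOne.norm_eq_tsum, ← tsum_mul_left]
  refine Summable.tsum_le_tsum (fun K => ?_) (hf (f - g)) ((f - g).summable_norm.mul_left C)
  rw [mul_comm]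
  exact mul_le_mul_of_nonneg_right (hC K) (norm_nonneg _)

theorem wmul_zero {c : ι → ℝ} : wmul c (0 : EllOne ι) = 0 := by
  have h : Memℓp (fun K => (c K : ℂ) * (0 : EllOne ι) K) 1 := by simp [memℓp_one_iff, summable_zero]
  rw [wmul, dif_pos h]
  ext K
  simp

theorem norm_wmul_le {c : ι → ℝ} {C : ℝ} (hc : ∀ K, 0 ≤ c K) (hC : ∀ K, c K ≤ C)
    (f : EllOne ι) : ‖wmul c f‖ ≤ C * ‖f‖ := by
  simpa only [wmul_zero, sub_zero] using norm_wmul_sub_le hc hC f 0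

theorem tendsto_wmul {α : Type*} {l : Filter α} {c : α → ι → ℝ} {c₀ : ι → ℝ} {C : ℝ}
    {f : α → EllOne ι} {f₀ : EllOne ι} (hc : ∀ᶠ a in l, ∀ K, 0 ≤ c a K ∧ c a K ≤ C)
    (hc₀ : ∀ K, 0 ≤ c₀ K ∧ c₀ K ≤ C) (hcl : ∀ K, Tendsto (fun a => c a K) l (𝓝 (c₀ K)))
    (hf : Tendsto f l (𝓝 f₀)) : Tendsto (fun a => wmul (c a) (f a)) l (𝓝 (wmul c₀ f₀)) := by
  rw [tendsto_iff_norm_sub_tendsto_zero] at hf ⊢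
  have h2 : Tendsto (fun a => ∑' K, |c a K - c₀ K| * ‖f₀ K‖) l (𝓝 (∑' _ : ι, 0)) := by
    refine tendsto_tsum_of_dominated_convergence (f₀.summable_norm.mul_left C) (fun K => ?_) ?_
    · simpa using ((hcl K).sub_const (c₀ K)).abs.mul_const ‖f₀ K‖
    · filter_upwards [hc] with a ha K
      rw [norm_mul, norm_norm, Real.norm_eq_abs, abs_abs]
      gcongr
      rw [abs_le]
      constructor <;> linarith [ha K, hc₀ K]
  rw [tsum_zero] at h2
  have h3 := (hf.const_mul C).add h2
  rw [mul_zero, add_zero] at h3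
  refine squeeze_zero' (Eventually.of_forall fun _ => norm_nonneg _) ?_ h3
  filter_upwards [hc] with a ha
  have hs := summable_norm_mul_of_bound (fun K => (ha K).1) (fun K => (ha K).2)
  have hs₀ := summable_norm_mul_of_bound (fun K => (hc₀ K).1) (fun K => (hc₀ K).2)
  calc ‖wmul (c a) (f a) - wmul c₀ f₀‖
      ≤ ‖wmul (c a) (f a) - wmul (c a) f₀‖ + ‖wmul (c a) f₀ - wmul c₀ f₀‖ :=
        norm_sub_le_norm_sub_add_norm_sub _ _ _
    _ ≤ C * ‖f a - f₀‖ + ∑' K, |c a K - c₀ K| * ‖f₀ K‖ := by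
        refine add_le_add (norm_wmul_sub_le (fun K => (ha K).1) (fun K => (ha K).2) _ _) ?_
        rw [EllOne.norm_eq_tsum]
        refine (tsum_congr fun K => ?_).le
        rw [lp.coeFn_sub, Pi.sub_apply, wmul_apply (hs f₀) (fun K => (ha K).1),
          wmul_apply (hs₀ f₀) (fun K => (hc₀ K).1), ← sub_mul, norm_mul, ← Complex.ofReal_sub,
          Complex.norm_real, Real.norm_eq_abs]

end WeightedEllOne

section TwistedConvolution

variable {G : Type*} [AddCommGroup G]

theorem summable_conv_norm (a b : EllOne G) :
    Summable fun p : G × G => ‖a (p.1 - p.2)‖ * ‖b p.2‖ := by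
  let e : G × G ≃ G × G := ⟨fun p => (p.1 - p.2, p.2), fun p => (p.1 + p.2, p.2),
    fun p => by simp, fun p => by simp⟩
  exact (e.summable_iff (f := fun p : G × G => ‖a p.1‖ * ‖b p.2‖)).2
    (a.summable_norm.mul_of_nonneg b.summable_norm (fun _ => norm_nonneg _) fun _ => norm_nonneg _)

theorem tsum_conv_norm (a b : EllOne G) :
    ∑' K, ∑' L, ‖a (K - L)‖ * ‖b L‖ = ‖a‖ * ‖b‖ := by
  let e : G × G ≃ G × G := ⟨fun p => (p.1 - p.2, p.2), fun p => (p.1 + p.2, p.2),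
    fun p => by simp, fun p => by simp⟩
  have h := summable_conv_norm a b
  rw [← h.tsum_prod, EllOne.norm_eq_tsum a, EllOne.norm_eq_tsum b,
    tsum_mul_tsum_of_summable_norm (by simpa using a.summable_norm)
      (by simpa using b.summable_norm)]
  exact e.tsum_eq (fun p : G × G => ‖a p.1‖ * ‖b p.2‖)

variable {κ : G → G → ℝ}

theorem norm_twisted_le (hκ : ∀ K L, |κ K L| ≤ 1) (a b : EllOne G) (K L : G) :
    ‖(κ K L : ℂ) * (a (K - L) * b L)‖ ≤ ‖a (K - L)‖ * ‖b L‖ := by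
  rw [norm_mul, norm_mul, Complex.norm_real, Real.norm_eq_abs]
  exact mul_le_of_le_one_left (by positivity) (hκ K L)

theorem summable_twisted (hκ : ∀ K L, |κ K L| ≤ 1) (a b : EllOne G) (K : G) :
    Summable fun L => (κ K L : ℂ) * (a (K - L) * b L) :=
  Summable.of_norm_bounded ((summable_conv_norm a b).prod_factor K)
    fun L => norm_twisted_le hκ a b K L

theorem norm_tsum_twisted_le (hκ : ∀ K L, |κ K L| ≤ 1) (a b : EllOne G) (K : G) :
    ‖∑' L, (κ K L : ℂ) * (a (K - L) * b L)‖ ≤ ∑' L, ‖a (K - L)‖ * ‖b L‖ :=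
  tsum_of_norm_bounded ((summable_conv_norm a b).prod_factor K).hasSum
    fun L => norm_twisted_le hκ a b K L

theorem summable_norm_tsum_twisted (hκ : ∀ K L, |κ K L| ≤ 1) (a b : EllOne G) :
    Summable fun K => ‖∑' L, (κ K L : ℂ) * (a (K - L) * b L)‖ :=
  Summable.of_nonneg_of_le (fun _ => norm_nonneg _) (norm_tsum_twisted_le hκ a b)
    (summable_conv_norm a b).prod

/-- Convolution on `ℓ¹(G)` twisted by a kernel bounded by `1`, as a bounded bilinear map. -/
noncomputable def twistedConv (κ : G → G → ℝ) (hκ : ∀ K L, |κ K L| ≤ 1) :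
    EllOne G →L[ℝ] EllOne G →L[ℝ] EllOne G :=
  LinearMap.mkContinuous₂
    (LinearMap.mk₂ ℝ
      (fun a b => ⟨fun K => ∑' L, (κ K L : ℂ) * (a (K - L) * b L),
        memℓp_one_iff.2 (summable_norm_tsum_twisted hκ a b)⟩)
      (fun a a' b => by
        ext K
        simp only [lp.coeFn_add, Pi.add_apply]
        rw [← (summable_twisted hκ a b K).tsum_add (summable_twisted hκ a' b K)]
        exact tsum_congr fun L => by ring)
      (fun r a b => by
        ext K
        simp only [lp.coeFn_smul, Pi.smul_apply, Complex.real_smul]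
        rw [← tsum_mul_left]
        exact tsum_congr fun L => by ring)
      (fun a b b' => by
        ext K
        simp only [lp.coeFn_add, Pi.add_apply]
        rw [← (summable_twisted hκ a b K).tsum_add (summable_twisted hκ a b' K)]
        exact tsum_congr fun L => by ring)
      (fun r a b => by
        ext K
        simp only [lp.coeFn_smul, Pi.smul_apply, Complex.real_smul]
        rw [← tsum_mul_left]
        exact tsum_congr fun L => by ring))
    1
    (fun a b => by
      rw [one_mul, ← tsum_conv_norm, EllOne.norm_eq_tsum]
      exact (summable_norm_tsum_twisted hκ a b).tsum_le_tsum (norm_tsum_twisted_le hκ a b)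
        (summable_conv_norm a b).prod)

theorem twistedConv_apply (hκ : ∀ K L, |κ K L| ≤ 1) (a b : EllOne G) (K : G) :
    twistedConv κ hκ a b K = ∑' L, (κ K L : ℂ) * (a (K - L) * b L) := rfl

theorem norm_twistedConv_le (hκ : ∀ K L, |κ K L| ≤ 1) (a b : EllOne G) :
    ‖twistedConv κ hκ a b‖ ≤ ‖a‖ * ‖b‖ := by
  have h := (twistedConv κ hκ).le_of_opNorm₂_le_of_le
    (LinearMap.mkContinuous₂_norm_le _ zero_le_one _) (le_refl ‖a‖) (le_refl ‖b‖)
  simpa using h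

theorem summable_norm_conj_neg (a : EllOne G) :
    Summable fun K => ‖(starRingEnd ℂ) (a (-K))‖ := by
  simp only [RCLike.norm_conj]
  exact (Equiv.neg G).summable_iff (f := fun K => ‖a K‖) |>.2 a.summable_norm

/-- The conjugate reflection `a ↦ (K ↦ conj (a (-K)))` of `ℓ¹(G)`. -/
noncomputable def conjNeg : EllOne G →L[ℝ] EllOne G :=
  LinearMap.mkContinuous
    { toFun := fun a => ⟨fun K => (starRingEnd ℂ) (a (-K)),
        memℓp_one_iff.2 (summable_norm_conj_neg a)⟩
      map_add' := fun a b => by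
        ext K
        exact map_add (starRingEnd ℂ) (a (-K)) (b (-K))
      map_smul' := fun r a => by ext K; simp }
    1
    (fun a => by
      rw [one_mul, EllOne.norm_eq_tsum, EllOne.norm_eq_tsum]
      simpa using ((Equiv.neg G).tsum_eq fun K => ‖a K‖).le)

theorem conjNeg_apply (a : EllOne G) (K : G) : conjNeg a K = (starRingEnd ℂ) (a (-K)) := rfl

theorem norm_conjNeg_le (a : EllOne G) : ‖conjNeg a‖ ≤ ‖a‖ :=
  (ContinuousLinearMap.le_of_opNorm_le _
    (LinearMap.mkContinuous_norm_le _ zero_le_one _) a).trans_eq (one_mul _)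

/-- The cubic term `a * a * C a` for the twisted convolution. -/
noncomputable def twistedCubic (κ : G → G → ℝ) (hκ : ∀ K L, |κ K L| ≤ 1) (a : EllOne G) :
    EllOne G :=
  twistedConv κ hκ (twistedConv κ hκ a a) (conjNeg a)

theorem continuous_twistedCubic (hκ : ∀ K L, |κ K L| ≤ 1) : Continuous (twistedCubic κ hκ) := by
  unfold twistedCubic
  fun_prop

theorem norm_twistedCubic_le (hκ : ∀ K L, |κ K L| ≤ 1) (a : EllOne G) :
    ‖twistedCubic κ hκ a‖ ≤ ‖a‖ ^ 3 := by
  calc _ ≤ ‖twistedConv κ hκ a a‖ * ‖conjNeg a‖ := norm_twistedConv_le hκ _ _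
    _ ≤ (‖a‖ * ‖a‖) * ‖a‖ := by
      gcongr
      exacts [norm_twistedConv_le hκ a a, norm_conjNeg_le a]
    _ = ‖a‖ ^ 3 := by ring

theorem norm_twistedCubic_sub_le (hκ : ∀ K L, |κ K L| ≤ 1) {R : ℝ} {a b : EllOne G}
    (ha : ‖a‖ ≤ R) (hb : ‖b‖ ≤ R) :
    ‖twistedCubic κ hκ a - twistedCubic κ hκ b‖ ≤ 3 * R ^ 2 * ‖a - b‖ := by
  have hR : 0 ≤ R := (norm_nonneg a).trans ha
  have hconv : ∀ x y z : EllOne G, ‖twistedConv κ hκ (twistedConv κ hκ x y) (conjNeg z)‖ ≤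
      ‖x‖ * ‖y‖ * ‖z‖ := fun x y z =>
    (norm_twistedConv_le hκ _ _).trans (mul_le_mul (norm_twistedConv_le hκ _ _)
      (norm_conjNeg_le z) (norm_nonneg _) (by positivity))
  have hsplit : twistedCubic κ hκ a - twistedCubic κ hκ b =
      twistedConv κ hκ (twistedConv κ hκ (a - b) a) (conjNeg a) +
      twistedConv κ hκ (twistedConv κ hκ b (a - b)) (conjNeg a) +
      twistedConv κ hκ (twistedConv κ hκ b b) (conjNeg (a - b)) := by
    simp only [twistedCubic, map_sub, sub_apply]
    abel
  calc _ ≤ ‖a - b‖ * ‖a‖ * ‖a‖ + ‖b‖ * ‖a - b‖ * ‖a‖ + ‖b‖ * ‖b‖ * ‖a - b‖ := by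
        rw [hsplit]
        exact norm_add₃_le.trans (add_le_add_three (hconv _ _ _) (hconv _ _ _) (hconv _ _ _))
    _ ≤ ‖a - b‖ * R * R + R * ‖a - b‖ * R + R * R * ‖a - b‖ := by gcongr
    _ = 3 * R ^ 2 * ‖a - b‖ := by ring

end TwistedConvolution

section LatticeWeights

variable {d : ℕ}

theorem one_le_one_add_normSq (K : Fin d → ℤ) : (1 : ℝ) ≤ 1 + ∑ i, ((K i : ℝ)) ^ 2 :=
  le_add_of_nonneg_right (Finset.sum_nonneg fun _ _ => sq_nonneg _)

theorem wt_pos (r : ℝ) (K : Fin d → ℤ) : 0 < wt d r K :=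
  Real.rpow_pos_of_pos (zero_lt_one.trans_le (one_le_one_add_normSq K)) _

theorem wt_mono {r s : ℝ} (h : r ≤ s) (K : Fin d → ℤ) : wt d r K ≤ wt d s K :=
  Real.rpow_le_rpow_of_exponent_le (one_le_one_add_normSq K) (by linarith)

theorem wt_add (r s : ℝ) (K : Fin d → ℤ) : wt d (r + s) K = wt d r K * wt d s K := by
  rw [wt, add_div, Real.rpow_add (zero_lt_one.trans_le (one_le_one_add_normSq K)), wt, wt]

theorem wt_neg_arg (r : ℝ) (K : Fin d → ℤ) : wt d r (-K) = wt d r K := by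
  simp [wt]

/-- Peetre's inequality for the weight of order one. -/
theorem wt_one_le_mul (K L : Fin d → ℤ) : wt d 1 K ≤ 2 * (wt d 1 (K - L) * wt d 1 L) := by
  have hsum : ∑ i, ((K i : ℝ)) ^ 2 ≤
      2 * ∑ i, (((K - L) i : ℤ) : ℝ) ^ 2 + 2 * ∑ i, ((L i : ℝ)) ^ 2 := by
    rw [Finset.mul_sum, Finset.mul_sum, ← Finset.sum_add_distrib]
    refine Finset.sum_le_sum fun i _ => ?_
    rw [Pi.sub_apply]
    push_cast
    nlinarith [sq_nonneg ((K i : ℝ) - 2 * L i)]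
  have h1 := one_le_one_add_normSq (K - L)
  have h2 := one_le_one_add_normSq L
  simp only [wt, ← Real.sqrt_eq_rpow]
  rw [← Real.sqrt_mul (by linarith), Real.sqrt_le_left (by positivity), mul_pow,
    Real.sq_sqrt (by nlinarith)]
  nlinarith

variable (d) in
/-- The weight `2 (1 + |K|²)^{1/2}`, which is submultiplicative. -/
noncomputable def algWt (K : Fin d → ℤ) : ℝ := 2 * wt d 1 K

theorem algWt_pos (K : Fin d → ℤ) : 0 < algWt d K := mul_pos two_pos (wt_pos 1 K)

theorem ofReal_algWt_ne_zero (K : Fin d → ℤ) : (algWt d K : ℂ) ≠ 0 :=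
  Complex.ofReal_ne_zero.2 (algWt_pos K).ne'

theorem algWt_le_mul (K L : Fin d → ℤ) : algWt d K ≤ algWt d (K - L) * algWt d L := by
  have := wt_one_le_mul K L
  unfold algWt
  linarith

variable (d) in
/-- The convolution kernel obtained by conjugating convolution with `algWt`. -/
noncomputable def algKernel (K L : Fin d → ℤ) : ℝ := algWt d K / (algWt d (K - L) * algWt d L)

theorem abs_algKernel_le (K L : Fin d → ℤ) : |algKernel d K L| ≤ 1 := by
  have := mul_pos (algWt_pos (K - L)) (algWt_pos L)
  rw [algKernel, abs_of_nonneg (div_nonneg (algWt_pos K).le this.le), div_le_one this]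
  exact algWt_le_mul K L

theorem twistedConv_algKernel {a b : EllOne (Fin d → ℤ)} {f g : (Fin d → ℤ) → ℂ}
    (ha : ∀ K, a K = algWt d K * f K) (hb : ∀ K, b K = algWt d K * g K) (K : Fin d → ℤ) :
    twistedConv (algKernel d) abs_algKernel_le a b K = algWt d K * dconv d f g K := by
  rw [twistedConv_apply, dconv, ← tsum_mul_left]
  refine tsum_congr fun L => ?_
  have h1 := ofReal_algWt_ne_zero (K - L)
  have h2 := ofReal_algWt_ne_zero L
  rw [ha, hb, algKernel]
  push_cast
  field_simp

theorem twistedCubic_algKernel {a : EllOne (Fin d → ℤ)} {f : (Fin d → ℤ) → ℂ}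
    (ha : ∀ K, a K = algWt d K * f K) (K : Fin d → ℤ) :
    twistedCubic (algKernel d) abs_algKernel_le a K =
      algWt d K * dconv d (dconv d f f) (cjop d f) K := by
  refine twistedConv_algKernel (twistedConv_algKernel ha ha) (fun K => ?_) K
  rw [conjNeg_apply, ha, map_mul, Complex.conj_ofReal, cjop, algWt, algWt, wt_neg_arg]

end LatticeWeights

section HeatPropagator

open Set Filter Topology MeasureTheory

variable {d : ℕ}

variable (d) in
/-- The heat multiplier `e^{-(4|K|²+1)t}`. -/
noncomputable def heatSymbol (t : ℝ) (K : Fin d → ℤ) : ℝ :=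
  Real.exp (-((4 * ∑ i, ((K i : ℝ)) ^ 2) + 1) * t)

theorem heatSymbol_le_one {t : ℝ} (ht : 0 ≤ t) (K : Fin d → ℤ) : heatSymbol d t K ≤ 1 := by
  rw [heatSymbol, Real.exp_le_one_iff]
  nlinarith [one_le_one_add_normSq K]

theorem continuous_heatSymbol (K : Fin d → ℤ) : Continuous fun t => heatSymbol d t K := by
  unfold heatSymbol
  fun_prop

variable (d) in
/-- The heat propagator on `ℓ¹`, frozen at the identity for negative times. -/
noncomputable def heat (t : ℝ) (f : EllOne (Fin d → ℤ)) : EllOne (Fin d → ℤ) :=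
  wmul (heatSymbol d (max t 0)) f

variable (d) in
/-- The heat propagator followed by multiplication with the weight of order `σ`. -/
noncomputable def weightedHeat (σ t : ℝ) (f : EllOne (Fin d → ℤ)) : EllOne (Fin d → ℤ) :=
  wmul (fun K => wt d σ K * heatSymbol d t K) f

theorem heatSymbol_nonneg (t : ℝ) (K : Fin d → ℤ) : 0 ≤ heatSymbol d t K := (Real.exp_pos _).le

theorem heat_apply {t : ℝ} (ht : 0 ≤ t) (f : EllOne (Fin d → ℤ)) (K : Fin d → ℤ) :
    heat d t f K = heatSymbol d t K * f K := by
  rw [heat, max_eq_left ht, wmul_apply (summable_norm_mul_of_bound (heatSymbol_nonneg _)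
    (heatSymbol_le_one ht) f) (heatSymbol_nonneg _)]

theorem heat_zero (t : ℝ) : heat d t 0 = 0 := wmul_zero

theorem norm_heat_sub_le (t : ℝ) (f g : EllOne (Fin d → ℤ)) :
    ‖heat d t f - heat d t g‖ ≤ ‖f - g‖ :=
  (norm_wmul_sub_le (heatSymbol_nonneg (max t 0)) (heatSymbol_le_one (le_max_right t 0))
    f g).trans_eq (one_mul _)

theorem continuous_heat : Continuous (Function.uncurry (heat d)) := by
  refine continuous_iff_continuousAt.2 fun p => ?_
  refine tendsto_wmul (C := 1) (Eventually.of_forall fun q K => ?_) (fun K => ?_) (fun K => ?_)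
    continuous_snd.continuousAt
  · exact ⟨heatSymbol_nonneg _ K, heatSymbol_le_one (le_max_right _ _) K⟩
  · exact ⟨heatSymbol_nonneg _ K, heatSymbol_le_one (le_max_right _ _) K⟩
  · exact ((continuous_heatSymbol K).comp (by fun_prop : Continuous fun q : ℝ × _ =>
      max q.1 0)).continuousAt

theorem weightedHeat_nonneg (σ t : ℝ) (K : Fin d → ℤ) : 0 ≤ wt d σ K * heatSymbol d t K :=
  mul_nonneg (wt_pos σ K).le (heatSymbol_nonneg t K)

/-- Parabolic smoothing: the heat multiplier gains `σ` derivatives at the cost `t^{-σ/2}`. -/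
theorem wt_mul_heatSymbol_le {σ t : ℝ} (hσ0 : 0 ≤ σ) (hσ2 : σ ≤ 2) (ht : 0 < t)
    (K : Fin d → ℤ) : wt d σ K * heatSymbol d t K ≤ t ^ (-(σ / 2)) := by
  set x := 1 + ∑ i, ((K i : ℝ)) ^ 2 with hx
  have hx1 : 1 ≤ x := one_le_one_add_normSq K
  have hx0 : 0 < x := zero_lt_one.trans_le hx1
  have hy : 0 < x * t := mul_pos hx0 ht
  have h1 : heatSymbol d t K ≤ Real.exp (-(x * t)) := by
    rw [heatSymbol, Real.exp_le_exp]
    nlinarith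
  have h2 : (x * t) ^ (σ / 2) ≤ Real.exp (x * t) := by
    rcases le_total (x * t) 1 with h | h
    · exact (Real.rpow_le_one hy.le h (by linarith)).trans (Real.one_le_exp hy.le)
    · calc (x * t) ^ (σ / 2) ≤ (x * t) ^ (1 : ℝ) :=
            Real.rpow_le_rpow_of_exponent_le h (by linarith)
        _ = x * t := Real.rpow_one _
        _ ≤ Real.exp (x * t) := by linarith [Real.add_one_le_exp (x * t)]
  have h3 : wt d σ K = (x * t) ^ (σ / 2) * t ^ (-(σ / 2)) := by
    rw [Real.mul_rpow hx0.le ht.le, mul_assoc, ← Real.rpow_add ht, add_neg_cancel,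
      Real.rpow_zero, mul_one, wt]
  have ht' := Real.rpow_nonneg ht.le (-(σ / 2))
  calc wt d σ K * heatSymbol d t K
      ≤ (Real.exp (x * t) * t ^ (-(σ / 2))) * Real.exp (-(x * t)) := by
        rw [h3]
        gcongr
        exact heatSymbol_nonneg t K
    _ = t ^ (-(σ / 2)) := by
        rw [mul_right_comm, ← Real.exp_add, add_neg_cancel, Real.exp_zero, one_mul]

variable {σ : ℝ}

theorem weightedHeat_apply (hσ0 : 0 ≤ σ) (hσ2 : σ ≤ 2) {t : ℝ} (ht : 0 < t)
    (f : EllOne (Fin d → ℤ)) (K : Fin d → ℤ) :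
    weightedHeat d σ t f K = wt d σ K * (heatSymbol d t K * f K) := by
  rw [weightedHeat, wmul_apply (summable_norm_mul_of_bound (weightedHeat_nonneg σ t)
    (wt_mul_heatSymbol_le hσ0 hσ2 ht) f) (weightedHeat_nonneg σ t)]
  push_cast
  ring

theorem norm_weightedHeat_le (hσ0 : 0 ≤ σ) (hσ2 : σ ≤ 2) {t : ℝ} (ht : 0 < t)
    (f : EllOne (Fin d → ℤ)) : ‖weightedHeat d σ t f‖ ≤ t ^ (-(σ / 2)) * ‖f‖ :=
  norm_wmul_le (weightedHeat_nonneg σ t) (wt_mul_heatSymbol_le hσ0 hσ2 ht) f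

theorem continuousOn_weightedHeat (hσ0 : 0 ≤ σ) (hσ2 : σ ≤ 2) :
    ContinuousOn (Function.uncurry (weightedHeat d σ)) (Ioi 0 ×ˢ univ) := by
  rintro ⟨t₀, f₀⟩ ⟨ht₀ : 0 < t₀, -⟩
  have hb : ∀ t, t₀ / 2 < t → ∀ K : Fin d → ℤ,
      0 ≤ wt d σ K * heatSymbol d t K ∧ wt d σ K * heatSymbol d t K ≤ (t₀ / 2) ^ (-(σ / 2)) :=
    fun t ht K => ⟨weightedHeat_nonneg σ t K,
      (wt_mul_heatSymbol_le hσ0 hσ2 ((half_pos ht₀).trans ht) K).trans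
        (Real.rpow_le_rpow_of_nonpos (half_pos ht₀) ht.le (by linarith))⟩
  refine ContinuousAt.continuousWithinAt (tendsto_wmul ?_ (hb t₀ (half_lt_self ht₀))
    (fun K => ?_) continuous_snd.continuousAt)
  · filter_upwards [continuous_fst.continuousAt.eventually (lt_mem_nhds (half_lt_self ht₀))]
      with q hq using hb q.1 hq
  · exact (continuous_const.mul ((continuous_heatSymbol K).comp continuous_fst)).continuousAt

theorem integral_apply {g : ℝ → EllOne (Fin d → ℤ)} {a b : ℝ}
    (hg : IntervalIntegrable g volume a b) (K : Fin d → ℤ) :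
    (∫ τ in a..b, g τ) K = ∫ τ in a..b, g τ K :=
  ((lp.evalCLM ℝ (fun _ : Fin d → ℤ => ℂ) 1 K).intervalIntegral_comp_comm hg).symm

theorem duhamel_apply {g : ℝ → EllOne (Fin d → ℤ)} (hg : Continuous g)
    (x₀ : EllOne (Fin d → ℤ)) {t : ℝ} (ht : 0 ≤ t) (K : Fin d → ℤ) :
    (heat d t x₀ + ∫ τ in (0 : ℝ)..t, heat d (t - τ) (g τ)) K =
      heatSymbol d t K • x₀ K + ∫ τ in (0 : ℝ)..t, heatSymbol d (t - τ) K • g τ K := by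
  have hc := (continuous_heat (d := d)).comp (by fun_prop : Continuous fun τ : ℝ => (t - τ, g τ))
  simp only [Function.comp_def, Function.uncurry_apply_pair] at hc
  rw [lp.coeFn_add, Pi.add_apply, heat_apply ht, integral_apply (hc.intervalIntegrable _ _),
    Complex.real_smul]
  congr 1
  refine intervalIntegral.integral_congr fun τ hτ => ?_
  rw [uIcc_of_le ht] at hτ
  simp only [heat_apply (sub_nonneg.2 hτ.2), Complex.real_smul]

theorem weighted_duhamel_apply (hσ0 : 0 ≤ σ) (hσ2 : σ < 2) {g : ℝ → EllOne (Fin d → ℤ)}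
    (hg : Continuous g) {t : ℝ} (ht : 0 ≤ t) (K : Fin d → ℤ) :
    (∫ r in (0 : ℝ)..t, weightedHeat d σ r (g (t - r))) K =
      wt d σ K * ∫ τ in (0 : ℝ)..t, heatSymbol d (t - τ) K • g τ K := by
  rw [integral_apply (intervalIntegrable_singular_kernel (continuousOn_weightedHeat hσ0 hσ2.le)
    (fun r hr x => norm_weightedHeat_le hσ0 hσ2.le hr x) (by linarith) hg ht),
    ← intervalIntegral.integral_const_mul]
  have h := intervalIntegral.integral_comp_sub_left (a := 0) (b := t)
    (fun r => (wt d σ K : ℂ) * heatSymbol d r K • g (t - r) K) t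
  simp only [sub_sub_cancel, sub_self, sub_zero] at h
  rw [h]
  refine intervalIntegral.integral_congr_ae (ae_of_all _ fun r hr => ?_)
  rw [uIoc_of_le ht] at hr
  rw [weightedHeat_apply hσ0 hσ2.le hr.1, Complex.real_smul]

end HeatPropagator

section MildFormulation

open Set Filter Topology MeasureTheory

variable {d : ℕ}

theorem NormContOn.continuous_wmul {r T C : ℝ} {B : ℝ → (Fin d → ℤ) → ℂ} (hT : 0 ≤ T)
    (hB : ∀ t ∈ Icc 0 T, Summable fun K => ‖B t K‖ * wt d r K) (hcont : NormContOn d r T B)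
    {w : (Fin d → ℤ) → ℝ} (hw : ∀ K, 0 ≤ w K) (hwC : ∀ K, w K ≤ C * wt d r K) (hC : 0 < C) :
    Continuous fun t => wmul w (B (projIcc 0 T hT t)) := by
  have hsum : ∀ t ∈ Icc 0 T, Summable fun K => ‖B t K‖ * w K := fun t ht =>
    Summable.of_nonneg_of_le (fun K => mul_nonneg (norm_nonneg _) (hw K))
      (fun K => (mul_le_mul_of_nonneg_left (hwC K) (norm_nonneg _)).trans_eq
        (mul_left_comm _ _ _)) ((hB t ht).mul_left C)
  have hsub : ∀ t ∈ Icc 0 T, ∀ t' ∈ Icc 0 T,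
      Summable fun K => ‖B t' K - B t K‖ * wt d r K := fun t ht t' ht' =>
    Summable.of_nonneg_of_le (fun K => mul_nonneg (norm_nonneg _) (wt_pos r K).le)
      (fun K => (mul_le_mul_of_nonneg_right (norm_sub_le _ _) (wt_pos r K).le).trans_eq
        (add_mul _ _ _)) ((hB t' ht').add (hB t ht))
  suffices h : Continuous fun t : Icc (0 : ℝ) T => wmul w (B t) from h.comp continuous_projIcc
  refine Metric.continuous_iff.2 fun t ε hε => ?_
  obtain ⟨ν, hν, h⟩ := hcont t t.2 (ε / C) (div_pos hε hC)
  refine ⟨ν, hν, fun t' ht' => ?_⟩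
  rw [dist_eq_norm, norm_wmul_sub (hsum t' t'.2) (hsum t t.2) hw]
  have h1 := h t' t'.2 (by rwa [Subtype.dist_eq, Real.dist_eq] at ht')
  rw [lt_div_iff₀' hC, ← tsum_mul_left] at h1
  have hle : ∀ K, ‖B t' K - B t K‖ * w K ≤ C * (‖B t' K - B t K‖ * wt d r K) := fun K =>
    (mul_le_mul_of_nonneg_left (hwC K) (norm_nonneg _)).trans_eq (mul_left_comm _ _ _)
  have hs := (hsub t t.2 t' t'.2).mul_left C
  exact (Summable.tsum_le_tsum hle (Summable.of_nonneg_of_le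
    (fun K => mul_nonneg (norm_nonneg _) (hw K)) hle hs) hs).trans_lt h1

theorem summable_and_normContOn_of_continuousOn {r T : ℝ} {B : ℝ → (Fin d → ℤ) → ℂ}
    {y : ℝ → EllOne (Fin d → ℤ)} (hy : ContinuousOn y (Icc 0 T))
    (hyB : ∀ t ∈ Icc 0 T, ∀ K, y t K = wt d r K * B t K) :
    (∀ t ∈ Icc 0 T, Summable fun K => ‖B t K‖ * wt d r K) ∧ NormContOn d r T B := by
  refine ⟨fun t ht => (y t).summable_norm.congr fun K => ?_, fun t ht η hη => ?_⟩
  · rw [hyB t ht, norm_mul, Complex.norm_of_nonneg (wt_pos r K).le, mul_comm]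
  · obtain ⟨ν, hν, h⟩ := Metric.continuousOn_iff.1 hy t ht η hη
    refine ⟨ν, hν, fun t' ht' htt' => ?_⟩
    have h1 := h t' ht' (by rwa [Real.dist_eq])
    rw [dist_eq_norm, EllOne.norm_eq_tsum] at h1
    refine lt_of_eq_of_lt (tsum_congr fun K => ?_) h1
    rw [lp.coeFn_sub, Pi.sub_apply, hyB t ht, hyB t' ht', ← mul_sub, norm_mul,
      Complex.norm_of_nonneg (wt_pos r K).le, mul_comm]

variable (d) in
/-- The Ginzburg–Landau nonlinearity `2 z - 3 (x+z)*(x+z)*C(x+z)` in the weighted variables. -/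
noncomputable def glNonlinearity (z : ℝ → EllOne (Fin d → ℤ)) (t : ℝ)
    (x : EllOne (Fin d → ℤ)) : EllOne (Fin d → ℤ) :=
  (2 : ℝ) • z t - (3 : ℝ) • twistedCubic (algKernel d) abs_algKernel_le (x + z t)

variable {z : ℝ → EllOne (Fin d → ℤ)}

theorem continuous_glNonlinearity (hz : Continuous z) :
    Continuous (Function.uncurry (glNonlinearity d z)) := by
  have := continuous_twistedCubic (G := Fin d → ℤ) abs_algKernel_le
  unfold glNonlinearity Function.uncurry
  fun_prop

theorem norm_glNonlinearity_le {ζ R : ℝ} (hz : ∀ t, ‖z t‖ ≤ ζ) (t : ℝ)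
    {x : EllOne (Fin d → ℤ)} (hx : ‖x‖ ≤ R) :
    ‖glNonlinearity d z t x‖ ≤ 2 * ζ + 3 * (R + ζ) ^ 3 := by
  refine (norm_sub_le _ _).trans ?_
  rw [norm_smul, norm_smul, Real.norm_ofNat, Real.norm_ofNat]
  have h1 : ‖x + z t‖ ≤ R + ζ := (norm_add_le _ _).trans (add_le_add hx (hz t))
  have h2 := (norm_twistedCubic_le abs_algKernel_le (x + z t)).trans
    (pow_le_pow_left₀ (norm_nonneg _) h1 3)
  have h3 := hz t
  gcongr

theorem norm_glNonlinearity_sub_le {ζ R : ℝ} (hz : ∀ t, ‖z t‖ ≤ ζ) (t : ℝ)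
    {x y : EllOne (Fin d → ℤ)} (hx : ‖x‖ ≤ R) (hy : ‖y‖ ≤ R) :
    ‖glNonlinearity d z t x - glNonlinearity d z t y‖ ≤ 9 * (R + ζ) ^ 2 * ‖x - y‖ := by
  have h := norm_twistedCubic_sub_le abs_algKernel_le
    ((norm_add_le y (z t)).trans (add_le_add hy (hz t)))
    ((norm_add_le x (z t)).trans (add_le_add hx (hz t)))
  rw [add_sub_add_right_eq_sub, norm_sub_rev y x] at h
  rw [glNonlinearity, glNonlinearity, sub_sub_sub_cancel_left, ← smul_sub, norm_smul,
    Real.norm_ofNat]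
  linarith

theorem glNonlinearity_apply {t : ℝ} {x : EllOne (Fin d → ℤ)} {b Z : (Fin d → ℤ) → ℂ}
    (hx : ∀ K, x K = algWt d K * b K) (hz : ∀ K, z t K = algWt d K * Z K) (K : Fin d → ℤ) :
    glNonlinearity d z t x K = algWt d K * (2 * Z K - 3 * dconv d
      (dconv d (fun L => b L + Z L) (fun L => b L + Z L)) (cjop d (fun L => b L + Z L)) K) := by
  have h : ∀ K, (x + z t) K = algWt d K * (b K + Z K) := fun K => by
    rw [lp.coeFn_add, Pi.add_apply, hx, hz, mul_add]
  rw [glNonlinearity, lp.coeFn_sub, Pi.sub_apply, lp.coeFn_smul, lp.coeFn_smul, Pi.smul_apply,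
    Pi.smul_apply, twistedCubic_algKernel h, hz, Complex.real_smul, Complex.real_smul]
  push_cast
  ring

/-- The mild equation in `ℓ¹` for the weighted unknown is the mild equation for every Fourier
coefficient. -/
theorem mild_equation_iff {T : ℝ} (hz : Continuous z) {u : ℝ → EllOne (Fin d → ℤ)}
    (hu : Continuous u) {x₀ : EllOne (Fin d → ℤ)} {B Z : ℝ → (Fin d → ℤ) → ℂ}
    {B₀ : (Fin d → ℤ) → ℂ} (hB₀ : ∀ K, x₀ K = algWt d K * B₀ K)
    (hB : ∀ t ∈ Icc 0 T, ∀ K, u t K = algWt d K * B t K)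
    (hZ : ∀ t ∈ Icc 0 T, ∀ K, z t K = algWt d K * Z t K) :
    (∀ t ∈ Icc 0 T, u t = heat d t x₀ +
      ∫ τ in (0 : ℝ)..t, heat d (t - τ) (glNonlinearity d z τ (u τ))) ↔
    ∀ t ∈ Icc (0 : ℝ) T, ∀ K : Fin d → ℤ,
      B t K = (Real.exp (-((4 * ∑ i, ((K i : ℝ)) ^ 2) + 1) * t)) • B₀ K
      + ∫ τ in (0 : ℝ)..t,
          (Real.exp (-((4 * ∑ i, ((K i : ℝ)) ^ 2) + 1) * (t - τ))) •
            (2 * Z τ K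
              - 3 * dconv d
                  (dconv d (fun L => B τ L + Z τ L) (fun L => B τ L + Z τ L))
                  (cjop d (fun L => B τ L + Z τ L)) K) := by
  have hg : Continuous fun τ => glNonlinearity d z τ (u τ) :=
    (continuous_glNonlinearity hz).comp (by fun_prop : Continuous fun τ : ℝ => (τ, u τ))
  refine forall₂_congr fun t ht => ?_
  have hext : ∀ a b : EllOne (Fin d → ℤ), a = b ↔ ∀ K, a K = b K :=
    fun a b => ⟨fun h K => by rw [h], fun h => lp.ext (funext h)⟩
  rw [hext]
  refine forall_congr' fun K => ?_
  rw [duhamel_apply hg x₀ ht.1, hB t ht, hB₀, ← mul_right_inj' (b := B t K) (ofReal_algWt_ne_zero K), mul_add,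
    ← intervalIntegral.integral_const_mul, mul_smul_comm]
  refine Eq.congr_right ?_
  refine congrArg₂ (· + ·) rfl ?_
  refine intervalIntegral.integral_congr fun τ hτ => ?_
  rw [uIcc_of_le ht.1] at hτ
  have hτ' : τ ∈ Icc 0 T := ⟨hτ.1, hτ.2.trans ht.2⟩
  simp only [glNonlinearity_apply (hB τ hτ') (hZ τ hτ'), mul_smul_comm]
  rfl

/-- Parabolic regularity: a continuous mild `ℓ¹₁` solution with datum in `ℓ¹_{1+σ}`, `σ < 2`, is
a continuous path in `ℓ¹_{1+σ}`. -/
theorem regularity_of_mild {σ T : ℝ} (hσ0 : 0 ≤ σ) (hσ2 : σ < 2)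
    {g u : ℝ → EllOne (Fin d → ℤ)} (hg : Continuous g) {x₀ : EllOne (Fin d → ℤ)}
    {B : ℝ → (Fin d → ℤ) → ℂ} {B₀ : (Fin d → ℤ) → ℂ} (hx₀ : ∀ K, x₀ K = algWt d K * B₀ K)
    (hB₀ : Summable fun K => ‖B₀ K‖ * wt d (1 + σ) K)
    (hu : ∀ t ∈ Icc 0 T, u t = heat d t x₀ + ∫ τ in (0 : ℝ)..t, heat d (t - τ) (g τ))
    (hB : ∀ t ∈ Icc 0 T, ∀ K, u t K = algWt d K * B t K) :
    (∀ t ∈ Icc 0 T, Summable fun K => ‖B t K‖ * wt d (1 + σ) K) ∧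
      NormContOn d (1 + σ) T B := by
  let y₀ : EllOne (Fin d → ℤ) := wmul (wt d (1 + σ)) B₀
  have hcont := continuousOn_singular_duhamel (continuousOn_weightedHeat (d := d) hσ0 hσ2.le)
    (fun r hr x => norm_weightedHeat_le hσ0 hσ2.le hr x) (by linarith) hg T
  have hy : ContinuousOn (fun t => heat d t y₀ +
      (1 / 2 : ℝ) • ∫ r in (0 : ℝ)..t, weightedHeat d σ r (g (t - r))) (Icc 0 T) :=
    (continuous_heat.comp (by fun_prop : Continuous fun t : ℝ => (t, y₀))).continuousOn.add
      (hcont.fun_const_smul (1 / 2 : ℝ))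
  refine summable_and_normContOn_of_continuousOn hy fun t ht K => ?_
  have h1 := hB t ht K
  rw [hu t ht, duhamel_apply hg x₀ ht.1, hx₀] at h1
  rw [lp.coeFn_add, Pi.add_apply, heat_apply ht.1, lp.coeFn_smul, Pi.smul_apply,
    weighted_duhamel_apply hσ0 hσ2 hg ht.1, wmul_apply hB₀ fun K => (wt_pos _ K).le, wt_add]
  rw [Complex.real_smul, algWt] at h1
  rw [Complex.real_smul]
  push_cast at h1 ⊢
  linear_combination (wt d σ K : ℂ) / 2 * h1

end MildFormulation

/-- local existence and uniqueness of the mild solution of the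
shifted Ginzburg–Landau equation, with a continuous `ℓ¹₁`-valued forcing path
`Ẑ` bounded by `C_Z` and initial datum `B̂₀ ∈ ℓ¹_{3−δ'}`; the existence time
`T₀` depends only on `d`, `δ'`, `C_Z` and (a bound `C_{B₀}` on) `‖B̂₀‖_{ℓ¹_{3−δ'}}`. -/
theorem GL_local_existence_uniqueness (d : ℕ) (hd : 1 ≤ d)
    (δ' : ℝ) (hδ'0 : 0 < δ') (hδ'2 : δ' < 2)
    (T₁ : ℝ) (hT₁ : 0 < T₁) (CZ : ℝ) (hCZ : 0 < CZ) (CB0 : ℝ) (hCB0 : 0 ≤ CB0) :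
    ∃ T₀ ∈ Set.Ioc (0 : ℝ) T₁,
      ∀ Z : ℝ → (Fin d → ℤ) → ℂ,
        (∀ T ∈ Set.Icc (0 : ℝ) T₁, Summable (fun K => ‖Z T K‖ * wt d 1 K)) →
        (∀ T ∈ Set.Icc (0 : ℝ) T₁, ∑' K : Fin d → ℤ, ‖Z T K‖ * wt d 1 K ≤ CZ) →
        NormContOn d 1 T₁ Z →
        ∀ B₀ : (Fin d → ℤ) → ℂ,
          Summable (fun K => ‖B₀ K‖ * wt d (3 - δ') K) →
          (∑' K : Fin d → ℤ, ‖B₀ K‖ * wt d (3 - δ') K) ≤ CB0 →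
          ∃ B : ℝ → (Fin d → ℤ) → ℂ,
            IsMildSol d T₀ (3 - δ') Z B₀ B ∧
            ∀ B' : ℝ → (Fin d → ℤ) → ℂ, IsMildSol d T₀ (3 - δ') Z B₀ B' →
              ∀ T ∈ Set.Icc (0 : ℝ) T₀, ∀ K : Fin d → ℤ, B' T K = B T K := by
  have hσ0 : 0 ≤ 2 - δ' := by linarith
  have hσ2 : 2 - δ' < 2 := by linarith
  have hexp : 3 - δ' = 1 + (2 - δ') := by ring
  have hle : ∀ K : Fin d → ℤ, algWt d K ≤ 2 * wt d (3 - δ') K := fun K =>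
    mul_le_mul_of_nonneg_left (wt_mono (by linarith) K) zero_le_two
  have hnonneg : ∀ K : Fin d → ℤ, 0 ≤ algWt d K := fun K => (algWt_pos K).le
  set ζ := 2 * CZ with hζ
  set R := 2 * CB0 + 1 with hR
  set M := 2 * ζ + 3 * (R + ζ) ^ 3 with hM
  set L := 9 * (R + ζ) ^ 2 with hL
  have hM0 : 0 < M := by positivity
  have hL0 : 0 < L := by positivity
  refine ⟨min T₁ (min M⁻¹ (2 * L)⁻¹), ⟨by positivity, min_le_left _ _⟩, ?_⟩
  set T₀ := min T₁ (min M⁻¹ (2 * L)⁻¹) with hT₀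
  have hT₀0 : 0 ≤ T₀ := by positivity
  have hT₀1 : T₀ ≤ T₁ := min_le_left _ _
  have hT₀M : T₀ * M ≤ 1 :=
    (le_div_iff₀ hM0).1 (by
      rw [one_div]
      exact (min_le_right _ _).trans (min_le_left _ _))
  have hT₀L : T₀ * (2 * L) ≤ 1 :=
    (le_div_iff₀ (by positivity)).1 (by
      rw [one_div]
      exact (min_le_right _ _).trans (min_le_right _ _))
  intro Z hZsum hZle hZcont B₀ hB₀ hB₀le
  let z : ℝ → EllOne (Fin d → ℤ) := fun t => wmul (algWt d) (Z (Set.projIcc 0 T₁ hT₁.le t))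
  have hsumZ : ∀ t ∈ Set.Icc 0 T₁, Summable fun K => ‖Z t K‖ * algWt d K := fun t ht =>
    ((hZsum t ht).mul_left 2).congr fun K => by rw [algWt]; ring
  have hz : Continuous z := hZcont.continuous_wmul hT₁.le hZsum hnonneg (fun K => le_rfl) two_pos
  have hzle : ∀ t, ‖z t‖ ≤ ζ := fun t => by
    have ht := (Set.projIcc 0 T₁ hT₁.le t).2
    rw [norm_wmul (hsumZ _ ht) hnonneg, hζ]
    refine le_trans (le_of_eq ?_) (mul_le_mul_of_nonneg_left (hZle _ ht) zero_le_two)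
    rw [← tsum_mul_left]
    exact tsum_congr fun K => by rw [algWt]; ring
  have hzZ : ∀ t ∈ Set.Icc 0 T₀, ∀ K, z t K = algWt d K * Z t K := fun t ht K => by
    have ht' : t ∈ Set.Icc 0 T₁ := ⟨ht.1, ht.2.trans hT₀1⟩
    simp only [z, Set.projIcc_of_mem hT₁.le ht']
    exact wmul_apply (hsumZ t ht') hnonneg K
  have hterm : ∀ (b : (Fin d → ℤ) → ℂ) (K), ‖b K‖ * algWt d K ≤ 2 * (‖b K‖ * wt d (3 - δ') K) :=
    fun b K => (mul_le_mul_of_nonneg_left (hle K) (norm_nonneg _)).trans_eq (mul_left_comm _ _ _)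
  have hsum : ∀ b : (Fin d → ℤ) → ℂ, (Summable fun K => ‖b K‖ * wt d (3 - δ') K) →
      Summable fun K => ‖b K‖ * algWt d K := fun b hb =>
    Summable.of_nonneg_of_le (fun K => mul_nonneg (norm_nonneg _) (hnonneg K)) (hterm b)
      (hb.mul_left 2)
  let x₀ : EllOne (Fin d → ℤ) := wmul (algWt d) B₀
  have hx₀ : ∀ K, x₀ K = algWt d K * B₀ K := wmul_apply (hsum B₀ hB₀) hnonneg
  have hx₀le : ‖x₀‖ ≤ 2 * CB0 := by
    rw [norm_wmul (hsum B₀ hB₀) hnonneg]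
    refine (Summable.tsum_le_tsum (hterm B₀) (hsum B₀ hB₀) (hB₀.mul_left 2)).trans ?_
    rw [tsum_mul_left]
    exact mul_le_mul_of_nonneg_left hB₀le zero_le_two
  have hN := continuous_glNonlinearity hz
  obtain ⟨u, hu, hu_eq⟩ := exists_mild_solution continuous_heat norm_heat_sub_le heat_zero hN
    (R := R) (M := M) (L := L) (T := T₀) (x₀ := x₀)
    (fun t x hx => norm_glNonlinearity_le hzle t hx)
    (fun t x y hx hy => norm_glNonlinearity_sub_le hzle t hx hy)
    (by linarith) hT₀0 hM0.le hL0.le (by linarith)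
  let B : ℝ → (Fin d → ℤ) → ℂ := fun t K => u t K / algWt d K
  have huB : ∀ t ∈ Set.Icc 0 T₀, ∀ K, u t K = algWt d K * B t K := fun t _ K =>
    (mul_div_cancel₀ _ (ofReal_algWt_ne_zero K)).symm
  have hreg := regularity_of_mild (T := T₀) hσ0 hσ2 
    (hN.comp (by fun_prop : Continuous fun τ : ℝ => (τ, u τ))) hx₀
    (hexp ▸ hB₀) hu_eq huB
  rw [← hexp] at hreg
  refine ⟨B, ⟨hreg.1, hreg.2, (mild_equation_iff hz hu hx₀ huB hzZ).1 hu_eq⟩, ?_⟩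
  rintro B' ⟨hB'sum, hB'cont, hB'eq⟩ t ht K
  let v : ℝ → EllOne (Fin d → ℤ) := fun t => wmul (algWt d) (B' (Set.projIcc 0 T₀ hT₀0 t))
  have hv : Continuous v := hB'cont.continuous_wmul hT₀0 hB'sum hnonneg hle two_pos
  have hvB' : ∀ t ∈ Set.Icc 0 T₀, ∀ K, v t K = algWt d K * B' t K := fun t ht K => by
    simp only [v, Set.projIcc_of_mem hT₀0 ht]
    exact wmul_apply (hsum _ (hB'sum t ht)) hnonneg K
  have huv := mild_solution_unique continuous_heat norm_heat_sub_le hN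
    (fun r => ⟨9 * (r + ζ) ^ 2, by positivity,
      fun t x y hx hy => norm_glNonlinearity_sub_le hzle t hx hy⟩)
    hv hu ((mild_equation_iff hz hv hx₀ hvB' hzZ).2 hB'eq) hu_eq t ht
  refine mul_left_cancel₀ (ofReal_algWt_ne_zero K) ?_
  rw [← hvB' t ht, ← huB t ht, huv]
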